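/- Let λ/μ and α/β be basic skew diagrams where μ and β each consist of a single box row, i.e. length(μ) = length(β) = 1 (m = b = 1), both λ and α have at least 4 distinct part sizes, and s_{λ/μ} = s_{α/β}. Then λ/μ = α/β. -/

import Mathlib

open YoungDiagram
open scoped Classical

namespace LRSkew

/-- The cells of the skew diagram `lam/mu`. -/
def skewCells (lam mu : YoungDiagram) : Finset (ℕ × ℕ) := lam.cells \ mu.cells

/-- A semistandard filling of the skew shape `lam/mu`: entries are positive exactly on the
cells of the shape, rows are weakly increasing and columns are strictly increasing. -/
def IsSSYT (lam mu : YoungDiagram) (T : ℕ × ℕ → ℕ) : Prop :=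
  (∀ p, p ∈ skewCells lam mu ↔ T p ≠ 0) ∧
  (∀ i j1 j2, (i, j1) ∈ skewCells lam mu → (i, j2) ∈ skewCells lam mu → j1 ≤ j2 →
    T (i, j1) ≤ T (i, j2)) ∧
  (∀ i1 i2 j, (i1, j) ∈ skewCells lam mu → (i2, j) ∈ skewCells lam mu → i1 < i2 →
    T (i1, j) < T (i2, j))

/-- The number of entries equal to `k` among the cells read (in the reverse reading word:
right to left along rows, top row first) up to position `(i,j)`. -/
def prefixCount (lam mu : YoungDiagram) (T : ℕ × ℕ → ℕ) (i j k : ℕ) : ℕ :=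
  ((skewCells lam mu).filter fun p => (p.1 < i ∨ (p.1 = i ∧ j ≤ p.2)) ∧ T p = k).card

/-- The reverse reading word of the filling is a lattice word. -/
def IsLattice (lam mu : YoungDiagram) (T : ℕ × ℕ → ℕ) : Prop :=
  ∀ i j k, prefixCount lam mu T i j (k + 2) ≤ prefixCount lam mu T i j (k + 1)

/-- The number of entries of the filling equal to `k`. -/
def content (lam mu : YoungDiagram) (T : ℕ × ℕ → ℕ) (k : ℕ) : ℕ :=
  ((skewCells lam mu).filter fun p => T p = k).card

/-- A Littlewood–Richardson tableau of shape `lam/mu` and content `nu`. -/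
def IsLR (lam mu nu : YoungDiagram) (T : ℕ × ℕ → ℕ) : Prop :=
  IsSSYT lam mu T ∧ IsLattice lam mu T ∧ ∀ i, content lam mu T (i + 1) = nu.rowLen i

/-- The Littlewood–Richardson coefficient `c(lam; mu, nu)`. -/
noncomputable def lrCoeff (lam mu nu : YoungDiagram) : ℕ :=
  if mu ≤ lam then {T : ℕ × ℕ → ℕ | IsLR lam mu nu T}.ncard else 0

/-- Equality of the skew Schur functions `s_{lam/mu} = s_{alp/bet}`, expressed through
their expansions into Schur functions. -/
def SchurEq (lam mu alp bet : YoungDiagram) : Prop :=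
  ∀ nu : YoungDiagram, lrCoeff lam mu nu = lrCoeff alp bet nu

/-- The rectangular Young diagram `(k^l)` with `l` rows of length `k`. -/
def rect (k l : ℕ) : YoungDiagram :=
  ⟨Finset.range l ×ˢ Finset.range k, by
    intro a b hba ha
    simp only [Finset.coe_product, Set.mem_prod, Finset.mem_coe, Finset.mem_range] at ha ⊢
    exact ⟨lt_of_le_of_lt hba.1 ha.1, lt_of_le_of_lt hba.2 ha.2⟩⟩

/-- The complement of `nu` in the rectangle `(k^l)`, rotated by 180 degrees so that it is
again a partition: its parts are `(k - nu_l, …, k - nu_1)`. -/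
def complRect (k l : ℕ) (nu : YoungDiagram) : YoungDiagram :=
  ⟨(rect k l).cells.filter fun p => (l - 1 - p.1, k - 1 - p.2) ∉ nu, by
    intro a b hba ha
    simp only [Finset.coe_filter, Set.mem_setOf_eq, mem_cells] at ha ⊢
    refine ⟨(rect k l).isLowerSet hba ha.1, fun hmem => ha.2 ?_⟩
    exact nu.isLowerSet
      (Prod.mk_le_mk.mpr ⟨Nat.sub_le_sub_left hba.1 _, Nat.sub_le_sub_left hba.2 _⟩) hmem⟩

/-- The staircase partition `(n, n-1, …, 2, 1)`. -/
def staircase (n : ℕ) : YoungDiagram :=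
  ⟨(Finset.range n ×ˢ Finset.range n).filter fun p => p.1 + p.2 < n, by
    intro a b hba ha
    simp only [Finset.coe_filter, Set.mem_setOf_eq, Finset.mem_product, Finset.mem_range] at ha ⊢
    exact ⟨⟨lt_of_le_of_lt hba.1 ha.1.1, lt_of_le_of_lt hba.2 ha.1.2⟩,
      lt_of_le_of_lt (Nat.add_le_add hba.1 hba.2) ha.2⟩⟩

/-- A basic skew diagram: no empty rows and no empty columns. -/
def IsBasic (lam mu : YoungDiagram) : Prop :=
  (∀ i, i < lam.colLen 0 → mu.rowLen i < lam.rowLen i) ∧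
  (∀ j, j < lam.rowLen 0 → mu.colLen j < lam.colLen j)

/-- A (basic) skew diagram is connected iff consecutive rows share a column. -/
def IsConnectedSkew (lam mu : YoungDiagram) : Prop :=
  ∀ i, i + 1 < lam.colLen 0 → mu.rowLen i < lam.rowLen (i + 1)

/-- The number of distinct (positive) part sizes of a partition. -/
def dp (lam : YoungDiagram) : ℕ :=
  ((Finset.range (lam.colLen 0)).image fun i => lam.rowLen i).card

/-- A partition is a rectangle: all its parts are equal. -/
def IsRect (mu : YoungDiagram) : Prop :=
  ∀ i, i < mu.colLen 0 → mu.rowLen i = mu.rowLen 0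

/-- Cells of a skew diagram in the same connected component: the reflexive–transitive
closure of sharing a row or a column. -/
def SameComp (s : Finset (ℕ × ℕ)) : ℕ × ℕ → ℕ × ℕ → Prop :=
  Relation.ReflTransGen fun a b => a ∈ s ∧ b ∈ s ∧ (a.1 = b.1 ∨ a.2 = b.2)

/-- Two finite sets of boxes agree up to translation or 180°-rotation of each connected
component independently. -/
def UpToTransRot (s t : Finset (ℕ × ℕ)) : Prop :=
  ∃ f : ℕ × ℕ → ℕ × ℕ, Set.BijOn f ↑s ↑t ∧
    ∀ p ∈ s, ∀ q ∈ s, SameComp s p q →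
      (((f q).1 : ℤ) - (f p).1 = (q.1 : ℤ) - p.1 ∧ ((f q).2 : ℤ) - (f p).2 = (q.2 : ℤ) - p.2) ∨
      (((f q).1 : ℤ) - (f p).1 = (p.1 : ℤ) - q.1 ∧ ((f q).2 : ℤ) - (f p).2 = (p.2 : ℤ) - q.2)


/-- interlacing sequences -/
def HS (n : ℕ) (a : ℕ → ℕ) (m : ℕ) (x : ℕ → ℕ) : Prop :=
  (∀ i, a (i+1) ≤ x i ∧ x i ≤ a i) ∧ ∑ j ∈ Finset.range n, x j + m = ∑ j ∈ Finset.range n, a j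

lemma exists_pt (lo hi : ℕ → ℕ) (h : ∀ i, lo i ≤ hi i) (n : ℕ) : ∀ N : ℕ,
    ∑ j ∈ Finset.range n, lo j ≤ N → N ≤ ∑ j ∈ Finset.range n, hi j →
    ∃ x : ℕ → ℕ, (∀ i, lo i ≤ x i ∧ x i ≤ hi i) ∧ ∑ j ∈ Finset.range n, x j = N := by
  induction n with
  | zero =>
    intro N h1 h2
    refine ⟨lo, fun i => ⟨le_rfl, h i⟩, ?_⟩
    simp at h2 ⊢; omega
  | succ n ih =>
    intro N h1 h2
    rw [Finset.sum_range_succ] at h1 h2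
    have hle : ∑ j ∈ Finset.range n, lo j ≤ ∑ j ∈ Finset.range n, hi j :=
      Finset.sum_le_sum fun i _ => h i
    have hn := h n
    obtain ⟨x, hx, hs⟩ := ih (N - max (lo n) (N - ∑ j ∈ Finset.range n, hi j))
      (by omega) (by omega)
    refine ⟨Function.update x n (max (lo n) (N - ∑ j ∈ Finset.range n, hi j)), ?_, ?_⟩
    · intro i
      by_cases hi' : i = n
      · subst hi'; simp; omega
      · simpa [Function.update_of_ne hi'] using hx i
    · rw [Finset.sum_range_succ, Function.update_self]
      have : ∑ j ∈ Finset.range n, Function.update x n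
          (max (lo n) (N - ∑ j ∈ Finset.range n, hi j)) j = ∑ j ∈ Finset.range n, x j := by
        refine Finset.sum_congr rfl fun j hj => ?_
        rw [Function.update_of_ne]
        have := Finset.mem_range.1 hj; omega
      rw [this, hs]; omega

lemma sum_upd (f : ℕ → ℕ) (n i v : ℕ) (hi : i < n) :
    ∑ j ∈ Finset.range n, Function.update f i v j + f i = ∑ j ∈ Finset.range n, f j + v := by
  have hm : i ∈ Finset.range n := Finset.mem_range.2 hi
  rw [Finset.sum_update_of_mem hm, Finset.sdiff_singleton_eq_erase,
    ← Finset.add_sum_erase _ f hm]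
  omega

lemma sum_shift (a : ℕ → ℕ) (n : ℕ) (h : a n = 0) :
    ∑ j ∈ Finset.range n, a (j+1) + a 0 = ∑ j ∈ Finset.range n, a j := by
  rw [← Finset.sum_range_succ', Finset.sum_range_succ, h, add_zero]

lemma ex_fix (n : ℕ) (a : ℕ → ℕ) (ha : Antitone a) (h0 : a n = 0) (m i v : ℕ) (hi : i < n)
    (h1 : a (i+1) ≤ v) (h2 : v ≤ a i) (h3 : m + v ≤ a 0 + a (i+1)) (h4 : a i ≤ m + v) 
    : ∃ x, HS n a m x ∧ x i = v := by
  have s1 := sum_upd a n i v hi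
  have s2 := sum_upd (fun j => a (j+1)) n i v hi
  have s3 := sum_shift a n h0
  have s4 : a i ≤ ∑ j ∈ Finset.range n, a j :=
    Finset.single_le_sum (f := a) (fun _ _ => Nat.zero_le _) (Finset.mem_range.2 hi)
  have s5 : a (i+1) ≤ ∑ j ∈ Finset.range n, a (j+1) :=
    Finset.single_le_sum (f := fun j => a (j+1)) (fun _ _ => Nat.zero_le _) (Finset.mem_range.2 hi)
  obtain ⟨x, hx, hs⟩ := exists_pt (Function.update (fun j => a (j+1)) i v) (Function.update a i v)
    (by
      intro j
      by_cases hj : j = i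
      · subst hj; simp
      · simpa [Function.update_of_ne hj] using ha (Nat.le_succ j)) n
    (∑ j ∈ Finset.range n, a j - m) (by omega) (by omega)
  refine ⟨x, ⟨?_, by omega⟩, ?_⟩
  · intro j
    have := hx j
    by_cases hj : j = i
    · subst hj; simp at this; omega
    · simpa [Function.update_of_ne hj] using this
  · have := hx i
    simp at this; omega

lemma core (n : ℕ) (a b : ℕ → ℕ) (ha : Antitone a) (hb : Antitone b)
    (ha0 : ∀ i, n ≤ i → a i = 0) (hb0 : ∀ i, n ≤ i → b i = 0) (m m' : ℕ) (hm : 1 ≤ m)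
    (hma : m ≤ a 1) (hmb : m' ≤ b 1) (hS : ∀ x, HS n a m x ↔ HS n b m' x)
    (hk : ∀ i, ∃ k, k ≠ i ∧ k ≠ i + 1 ∧ a (k+1) < a k) : ∀ i, b i ≤ a i := by
  have hn : 1 < n := by
    by_contra hc
    have := ha0 1 (by omega); omega
  have a10 := ha (Nat.zero_le 1)
  have b10 := hb (Nat.zero_le 1)
  intro i
  rcases i with _ | i
  · obtain ⟨x, hx, hv⟩ := ex_fix n b hb (hb0 n le_rfl) m' 0 (b 0) (by omega) (hb (by omega)) le_rfl
      (by simp; omega) (by omega)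
    have := ((hS x).2 hx).1 0
    omega
  by_contra hlt
  push Not at hlt
  have hin : i + 1 < n := by
    by_contra hc
    have := hb0 (i+1) (by omega); omega
  have hai : a (i+1) ≤ a i := ha (by omega)
  have hbi : b (i+2) ≤ b (i+1) := hb (by omega)
  have c1 : m + a (i+1) < a i := by
    by_contra hc
    obtain ⟨x, hx, hv⟩ := ex_fix n a ha (ha0 n le_rfl) m i (a (i+1)) (by omega) le_rfl hai
      (by omega) (by omega)
    have := ((hS x).1 hx).1 i
    omega
  have c2 : b 0 + b (i+2) < m' + b (i+1) := by
    by_contra hc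
    obtain ⟨x, hx, hv⟩ := ex_fix n b hb (hb0 n le_rfl) m' (i+1) (b (i+1)) hin hbi le_rfl
      (show m' + b (i+1) ≤ b 0 + b (i+2) by omega) (by omega)
    have := ((hS x).2 hx).1 (i+1)
    omega
  obtain ⟨k, k1, k2, k3⟩ := hk i
  have hkn : k < n := by
    by_contra hc
    have := ha0 k (by omega); omega
  have hP : HS n a m (Function.update a i (a i - m)) := by
    refine ⟨fun j => ?_, ?_⟩
    · by_cases hj : j = i
      · subst hj; simp; omega
      · simpa [Function.update_of_ne hj] using ha (Nat.le_succ j)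
    · have := sum_upd a n i (a i - m) (by omega)
      omega
  have hP' : HS n a m (Function.update (Function.update a i (a i - m + 1)) k (a k - 1)) := by
    refine ⟨fun j => ?_, ?_⟩
    · by_cases hjk : j = k
      · subst hjk; simp; omega
      rw [Function.update_of_ne hjk]
      by_cases hj : j = i
      · subst hj; simp; omega
      · simpa [Function.update_of_ne hj] using ha (Nat.le_succ j)
    · have t1 := sum_upd a n i (a i - m + 1) (by omega)
      have t2 := sum_upd (Function.update a i (a i - m + 1)) n k (a k - 1) (by omega)
      rw [Function.update_of_ne k1] at t2
      omega
  have hQ : HS n b m' (Function.update (fun j => b (j+1)) (i+1) (b (i+2) + b 0 - m')) := by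
    refine ⟨fun j => ?_, ?_⟩
    · by_cases hj : j = i + 1
      · subst hj; simp only [Function.update_self, add_assoc, Nat.reduceAdd] at *; omega
      · simpa [Function.update_of_ne hj] using hb (Nat.le_succ j)
    · have t1 := sum_upd (fun j => b (j+1)) n (i+1) (b (i+2) + b 0 - m') (by omega)
      have t2 := sum_shift b n (hb0 n le_rfl)
      simp only [add_assoc, Nat.reduceAdd] at *
      omega
  have hPb := (hS _).1 hP
  have hPb' := (hS _).1 hP'
  have hQa := (hS _).2 hQ
  have hlt : ∑ j ∈ Finset.range n,
      (Function.update (fun j => b (j+1)) (i+1) (b (i+2) + b 0 - m')) j <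
      ∑ j ∈ Finset.range n,
        (Function.update (Function.update a i (a i - m + 1)) k (a k - 1)) j := by
    refine Finset.sum_lt_sum (fun j _ => ?_) ⟨i, Finset.mem_range.2 (by omega), ?_⟩
    · by_cases hj : j = i + 1
      · subst hj
        rw [Function.update_of_ne (Ne.symm k2), Function.update_of_ne (by omega : i + 1 ≠ i)]
        exact (hQa.1 _).2
      · rw [Function.update_of_ne hj]
        exact (hPb'.1 j).1
    · have := (hPb.1 i).1
      rw [Function.update_of_ne (by omega : i ≠ i + 1), Function.update_of_ne (Ne.symm k1)]
      simp at this ⊢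
      omega
  have e1 := hQa.2
  have e2 := hP'.2
  omega

lemma mu_row (mu : YoungDiagram) (hm : mu.colLen 0 = 1) (i : ℕ) (hi : 1 ≤ i) :
    mu.rowLen i = 0 := by
  by_contra hc
  have h : (i, 0) ∈ mu := mem_iff_lt_rowLen.2 (by omega)
  rw [mem_iff_lt_colLen] at h
  omega

lemma row_zero (lam : YoungDiagram) (i : ℕ) (hi : lam.colLen 0 ≤ i) : lam.rowLen i = 0 := by
  by_contra hc
  have h : (i, 0) ∈ lam := mem_iff_lt_rowLen.2 (by omega)
  rw [mem_iff_lt_colLen] at h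
  omega

lemma mem_skew (lam mu : YoungDiagram) (i j : ℕ) :
    (i, j) ∈ skewCells lam mu ↔ j < lam.rowLen i ∧ mu.rowLen i ≤ j := by
  unfold skewCells
  rw [Finset.mem_sdiff, mem_cells, mem_cells, mem_iff_lt_rowLen, mem_iff_lt_rowLen, not_lt]

/-- number of entries equal to `v` in row `i` -/
noncomputable def rowCount (lam mu : YoungDiagram) (T : ℕ × ℕ → ℕ) (i v : ℕ) : ℕ :=
  ((skewCells lam mu).filter fun p => p.1 = i ∧ T p = v).card

lemma row_card (lam mu : YoungDiagram) (i : ℕ) :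
    ((skewCells lam mu).filter fun p => p.1 = i).card = lam.rowLen i - mu.rowLen i := by
  have : ((skewCells lam mu).filter fun p => p.1 = i)
      = {i} ×ˢ Finset.Ico (mu.rowLen i) (lam.rowLen i) := by
    ext ⟨a, b⟩
    rw [Finset.mem_filter, mem_skew, Finset.mem_product, Finset.mem_singleton, Finset.mem_Ico]
    constructor
    · rintro ⟨⟨h1, h2⟩, rfl⟩; exact ⟨rfl, h2, h1⟩
    · rintro ⟨h0, h2, h1⟩
      simp only at h0 h1 h2
      subst h0; exact ⟨⟨h1, h2⟩, rfl⟩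
  rw [this]; simp

lemma upper (lam mu : YoungDiagram) (T : ℕ × ℕ → ℕ) (hT : IsSSYT lam mu T)
    (hL : IsLattice lam mu T) : ∀ i j, (i, j) ∈ skewCells lam mu → T (i, j) ≤ i + 1 := by
  intro i
  induction i using Nat.strong_induction_on with
  | _ i ih =>
    intro j hj
    by_contra hc
    obtain ⟨v, hv⟩ : ∃ v, T (i, j) = v + 2 := ⟨T (i, j) - 2, by omega⟩
    have h1 := hL i j v
    have h2 : 0 < prefixCount lam mu T i j (v + 2) := by
      unfold prefixCount
      refine Finset.card_pos.2 ⟨(i, j), ?_⟩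
      rw [Finset.mem_filter]
      exact ⟨hj, Or.inr ⟨rfl, le_rfl⟩, hv⟩
    have h3 : 0 < prefixCount lam mu T i j (v + 1) := by omega
    unfold prefixCount at h3
    obtain ⟨⟨a, b⟩, hp⟩ := Finset.card_pos.1 h3
    rw [Finset.mem_filter] at hp
    obtain ⟨hp1, hp2, hp3⟩ := hp
    rcases hp2 with hp2 | ⟨hp2, hp4⟩
    · have := ih a hp2 b hp1
      simp only at hp2
      omega
    · simp only at hp2 hp4
      subst hp2
      have := hT.2.1 a j b hj hp1 hp4
      omega

lemma lower (lam mu : YoungDiagram) (hm : mu.colLen 0 = 1) (T : ℕ × ℕ → ℕ)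
    (hT : IsSSYT lam mu T) : ∀ i j, (i, j) ∈ skewCells lam mu → i ≤ T (i, j) := by
  intro i
  induction i with
  | zero => intro j _; exact Nat.zero_le _
  | succ i ih =>
    intro j hj
    by_cases h0 : i = 0
    · subst h0
      have := (hT.1 _).1 hj
      omega
    have h1 : (i, j) ∈ skewCells lam mu := by
      rw [mem_skew] at hj ⊢
      have := lam.rowLen_anti i (i+1) (by omega)
      have := mu_row mu hm i (by omega)
      omega
    have := ih j h1
    have := hT.2.2 i (i+1) j h1 hj (by omega)
    omega

lemma rowCount_add (lam mu : YoungDiagram) (hm : mu.colLen 0 = 1) (T : ℕ × ℕ → ℕ)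
    (hT : IsSSYT lam mu T) (hL : IsLattice lam mu T) (i : ℕ) :
    rowCount lam mu T i i + rowCount lam mu T i (i+1) = lam.rowLen i - mu.rowLen i := by
  rw [← row_card]
  unfold rowCount
  rw [← Finset.card_union_of_disjoint]
  · congr 1
    ext ⟨a, b⟩
    simp only [Finset.mem_union, Finset.mem_filter]
    constructor
    · rintro (h | h)
      · exact ⟨h.1, h.2.1⟩
      · exact ⟨h.1, h.2.1⟩
    · rintro ⟨h1, rfl⟩
      have := upper lam mu T hT hL a b h1
      have := lower lam mu hm T hT a b h1
      by_cases h : T (a, b) = a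
      · exact Or.inl ⟨h1, rfl, h⟩
      · exact Or.inr ⟨h1, rfl, by omega⟩
  · rw [Finset.disjoint_left]
    intro p hp hq
    rw [Finset.mem_filter] at hp hq
    omega

lemma content_eq (lam mu : YoungDiagram) (hm : mu.colLen 0 = 1) (T : ℕ × ℕ → ℕ)
    (hT : IsSSYT lam mu T) (hL : IsLattice lam mu T) (v : ℕ) :
    content lam mu T (v+1) = rowCount lam mu T v (v+1) + rowCount lam mu T (v+1) (v+1) := by
  unfold rowCount content
  rw [← Finset.card_union_of_disjoint]
  · congr 1
    ext ⟨a, b⟩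
    simp only [Finset.mem_union, Finset.mem_filter]
    constructor
    · rintro ⟨h1, h2⟩
      have := upper lam mu T hT hL a b h1
      have := lower lam mu hm T hT a b h1
      by_cases h : a = v
      · exact Or.inl ⟨h1, h, h2⟩
      · exact Or.inr ⟨h1, by omega, h2⟩
    · rintro (h | h)
      · exact ⟨h.1, h.2.2⟩
      · exact ⟨h.1, h.2.2⟩
  · rw [Finset.disjoint_left]
    intro p hp hq
    rw [Finset.mem_filter] at hp hq
    omega

lemma rowCount_first (lam mu : YoungDiagram) (T : ℕ × ℕ → ℕ)
    (hT : IsSSYT lam mu T) : rowCount lam mu T 1 1 ≤ mu.rowLen 0 := by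
  unfold rowCount
  rw [← Finset.card_range (mu.rowLen 0)]
  refine Finset.card_le_card_of_injOn (fun p => p.2) ?_ ?_
  · rintro ⟨a, b⟩ h
    simp only [Finset.coe_filter, Set.mem_setOf_eq] at h
    obtain ⟨h1, rfl, h3⟩ := h
    simp only [Finset.coe_range, Set.mem_Iio]
    by_contra hc
    have h4 : (0, b) ∈ skewCells lam mu := by
      rw [mem_skew] at h1 ⊢
      have := lam.rowLen_anti 0 1 (by omega)
      omega
    have := hT.2.2 0 1 b h4 h1 (by omega)
    have := (hT.1 _).1 h4
    omega
  · rintro ⟨a, b⟩ h ⟨a', b'⟩ h' heq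
    simp only [Finset.coe_filter, Set.mem_setOf_eq] at h h' heq
    rw [h.2.1, h'.2.1, heq]

lemma rowCount_desc (lam mu : YoungDiagram) (hm : mu.colLen 0 = 1) (T : ℕ × ℕ → ℕ)
    (hT : IsSSYT lam mu T) (i : ℕ) (hi : 1 ≤ i) :
    rowCount lam mu T (i+1) (i+1) ≤ rowCount lam mu T i i := by
  unfold rowCount
  refine Finset.card_le_card_of_injOn (fun p => (i, p.2)) ?_ ?_
  · rintro ⟨a, b⟩ h
    simp only [Finset.coe_filter, Set.mem_setOf_eq] at h ⊢
    obtain ⟨h1, rfl, h3⟩ := h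
    have h4 : (i, b) ∈ skewCells lam mu := by
      rw [mem_skew] at h1 ⊢
      have := lam.rowLen_anti i (i+1) (by omega)
      have := mu_row mu hm i (by omega)
      omega
    have := hT.2.2 i (i+1) b h4 h1 (by omega)
    have := lower lam mu hm T hT i b h4
    exact ⟨h4, trivial, by omega⟩
  · rintro ⟨a, b⟩ h ⟨a', b'⟩ h' heq
    simp only [Finset.coe_filter, Set.mem_setOf_eq, Prod.mk.injEq] at h h' heq
    rw [h.2.1, h'.2.1, heq.2]

lemma rowCount_lattice (lam mu : YoungDiagram) (T : ℕ × ℕ → ℕ)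
    (hT : IsSSYT lam mu T) (hL : IsLattice lam mu T) (i : ℕ) :
    rowCount lam mu T (i+1) (i+2) ≤ rowCount lam mu T i (i+1) := by
  by_cases hex : ∃ j, (i+1, j) ∈ skewCells lam mu ∧ T (i+1, j) = i + 2
  · obtain ⟨hj1, hj2⟩ := Nat.find_spec hex
    have hmin := fun j (h : j < Nat.find hex) => Nat.find_min hex h
    set j := Nat.find hex with hjdef
    have h1 := hL (i+1) j i
    refine le_trans ?_ (h1.trans ?_)
    · unfold rowCount prefixCount
      refine Finset.card_le_card ?_
      rintro ⟨a, b⟩ h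
      simp only [Finset.mem_filter] at h ⊢
      obtain ⟨h1, rfl, h3⟩ := h
      refine ⟨h1, Or.inr ⟨rfl, ?_⟩, h3⟩
      by_contra hc
      exact hmin b (by omega) ⟨h1, h3⟩
    · unfold rowCount prefixCount
      refine Finset.card_le_card ?_
      rintro ⟨a, b⟩ h
      simp only [Finset.mem_filter] at h ⊢
      obtain ⟨h1, h2, h3⟩ := h
      refine ⟨h1, ?_, h3⟩
      rcases h2 with h2 | ⟨rfl, h2⟩
      · have := upper lam mu T hT hL a b h1
        omega
      · have := hT.2.1 (i+1) j b hj1 h1 h2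
        omega
  · have : rowCount lam mu T (i+1) (i+2) = 0 := by
      unfold rowCount
      rw [Finset.card_eq_zero, Finset.filter_eq_empty_iff]
      rintro ⟨a, b⟩ h ⟨rfl, h3⟩
      exact hex ⟨b, h, h3⟩
    omega

lemma forward (lam mu nu : YoungDiagram) (hmu : mu ≤ lam) (hm : mu.colLen 0 = 1) (n : ℕ)
    (hn : lam.colLen 0 ≤ n) (hn1 : 1 ≤ n) (T : ℕ × ℕ → ℕ) (h : IsLR lam mu nu T) :
    HS n lam.rowLen (mu.rowLen 0) nu.rowLen := by
  obtain ⟨hT, hL, hc⟩ := h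
  have hmu0 : mu.rowLen 0 ≤ lam.rowLen 0 := by
    by_contra hlt
    have h1 : (0, lam.rowLen 0) ∈ mu := mem_iff_lt_rowLen.2 (by omega)
    have := mem_iff_lt_rowLen.1 (hmu h1)
    omega
  have hz : rowCount lam mu T 0 0 = 0 := by
    unfold rowCount
    rw [Finset.card_eq_zero, Finset.filter_eq_empty_iff]
    rintro p h ⟨_, h3⟩
    exact (hT.1 p).1 h h3
  have r0 := rowCount_add lam mu hm T hT hL 0
  have rS : ∀ i, rowCount lam mu T (i+1) (i+1) + rowCount lam mu T (i+1) (i+2)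
      = lam.rowLen (i+1) := by
    intro i
    have := rowCount_add lam mu hm T hT hL (i+1)
    rw [mu_row mu hm (i+1) (by omega)] at this
    simpa using this
  have hnu : ∀ i, nu.rowLen i = rowCount lam mu T i (i+1) + rowCount lam mu T (i+1) (i+1) := by
    intro i
    rw [← hc i, content_eq lam mu hm T hT hL]
  have hfst := rowCount_first lam mu T hT
  refine ⟨fun i => ⟨?_, ?_⟩, ?_⟩
  · rw [hnu, ← rS]
    have := rowCount_lattice lam mu T hT hL i
    omega
  · rw [hnu]
    rcases i with _ | i
    · simp only [zero_add] at *; omega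
    · rw [← rS]
      have := rowCount_desc lam mu hm T hT (i+1) (by omega)
      simp only [add_assoc, Nat.reduceAdd] at *
      omega
  · have key : ∀ k, ∑ j ∈ Finset.range (k+1), nu.rowLen j + mu.rowLen 0
        = ∑ j ∈ Finset.range (k+1), lam.rowLen j + rowCount lam mu T (k+1) (k+1) := by
      intro k
      induction k with
      | zero =>
        have := hnu 0
        simp only [zero_add, Finset.sum_range_one] at *; omega
      | succ k ih =>
        rw [Finset.sum_range_succ, Finset.sum_range_succ _ (k+1), hnu (k+1), ← rS k]
        simp only [add_assoc, Nat.reduceAdd] at *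
        omega
    obtain ⟨k, rfl⟩ : ∃ k, n = k + 1 := ⟨n - 1, by omega⟩
    rw [key]
    have := rS k
    rw [row_zero lam (k+1) hn] at this
    omega

lemma lr_finite (lam mu nu : YoungDiagram) : {T : ℕ × ℕ → ℕ | IsLR lam mu nu T}.Finite := by
  have hfin : (Set.pi Set.univ fun p : ℕ × ℕ => (Set.univ : Set ℕ)) = Set.univ := by simp
  let g : (ℕ × ℕ → ℕ) → (skewCells lam mu → ℕ) := fun T p => T p
  refine Set.Finite.of_finite_image (f := g) ?_ ?_
  · refine (Set.Finite.pi' (t := fun _ : skewCells lam mu => Set.Iic (nu.colLen 0))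
      fun _ => Set.finite_Iic _).subset ?_
    rintro _ ⟨T, ⟨hT, _, hc⟩, rfl⟩ p
    show T p ≤ nu.colLen 0
    by_contra hlt
    have h1 := hc (T p - 1)
    rw [row_zero nu (T p - 1) (by omega), show T p - 1 + 1 = T p by omega] at h1
    unfold content at h1
    rw [Finset.card_eq_zero, Finset.filter_eq_empty_iff] at h1
    exact h1 p.2 rfl
  · intro T hT T' hT' heq
    funext p
    by_cases hp : p ∈ skewCells lam mu
    · exact congrFun heq ⟨p, hp⟩
    · have h1 := (hT.1.1 p).not.1 hp
      have h2 := (hT'.1.1 p).not.1 hp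
      push Not at h1 h2
      rw [h1, h2]

/-- the LR filling attached to the sequence `d` -/
noncomputable def fillT (lam mu : YoungDiagram) (d : ℕ → ℕ) (p : ℕ × ℕ) : ℕ :=
  if p ∈ skewCells lam mu then (if p.2 < d p.1 then p.1 else p.1 + 1) else 0

lemma fill_val (lam mu : YoungDiagram) (d : ℕ → ℕ) (i j : ℕ) (h : (i, j) ∈ skewCells lam mu) :
    fillT lam mu d (i, j) = if j < d i then i else i + 1 := by
  unfold fillT; rw [if_pos h]

lemma backward (lam mu nu : YoungDiagram) (hm : mu.colLen 0 = 1) (d : ℕ → ℕ)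
    (hd0 : d 0 = mu.rowLen 0) (hd : ∀ i, nu.rowLen i + d i = lam.rowLen i + d (i+1))
    (hdl : ∀ i, d i ≤ lam.rowLen i)
    (hI : ∀ i, lam.rowLen (i+1) ≤ nu.rowLen i ∧ nu.rowLen i ≤ lam.rowLen i) :
    IsLR lam mu nu (fillT lam mu d) := by
  have hda : ∀ i, d (i+1) ≤ d i := fun i => by have := hd i; have := hI i; omega
  have hmuS := mu_row mu hm
  have hnz : ∀ i j v, fillT lam mu d (i, j) = v + 1 ↔ (i, j) ∈ skewCells lam mu ∧
      (if j < d i then i else i + 1) = v + 1 := by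
    intro i j v
    by_cases h : (i, j) ∈ skewCells lam mu
    · rw [fill_val _ _ _ _ _ h]; simp [h]
    · unfold fillT; simp [h]
  refine ⟨⟨?_, ?_, ?_⟩, ?_, ?_⟩
  · rintro ⟨i, j⟩
    constructor
    · intro h
      rw [fill_val _ _ _ _ _ h]
      rw [mem_skew] at h
      rcases i with _ | i
      · rw [if_neg (by omega)]; omega
      · split_ifs <;> omega
    · intro h
      by_contra hc
      exact h (if_neg hc)
  · intro i j1 j2 h1 h2 h3
    rw [fill_val _ _ _ _ _ h1, fill_val _ _ _ _ _ h2]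
    split_ifs <;> omega
  · intro i1 i2 j h1 h2 h3
    rw [fill_val _ _ _ _ _ h1, fill_val _ _ _ _ _ h2]
    by_cases h4 : i2 = i1 + 1
    · subst h4
      have := hda i1
      split_ifs <;> omega
    · split_ifs <;> omega
  · intro i j k
    unfold prefixCount
    have hk1 := hd k
    have hk2 := hI k
    have hk3 := hda (k+1)
    have hk4 := hdl (k+1)
    have hk5 := hdl k
    have hk6 := lam.rowLen_anti k (k+1) (by omega)
    refine Finset.card_le_card_of_injOn (fun p => if p.1 = k + 1 then
      (k, p.2 + lam.rowLen k - lam.rowLen (k+1)) else (k+1, p.2)) ?_ ?_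
    · rintro ⟨a, b⟩ h
      simp only [Finset.coe_filter, Set.mem_setOf_eq] at h ⊢
      obtain ⟨h1, h2, h3⟩ := h
      rw [hnz a b (k+1)] at h3
      have h4 := h3.2
      rw [mem_skew] at h1
      by_cases hak : a = k + 1
      · subst hak
        rw [if_pos rfl]
        have h5 : ¬ b < d (k+1) := by
          intro hlt; rw [if_pos hlt] at h4; omega
        have h6 : (k, b + lam.rowLen k - lam.rowLen (k+1)) ∈ skewCells lam mu := by
          rw [mem_skew]
          refine ⟨by omega, ?_⟩
          rcases k with _ | k
          · simp only [zero_add] at *; omega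
          · rw [hmuS (k+1) (by omega)]; omega
        refine ⟨h6, by omega, ?_⟩
        rw [hnz]
        refine ⟨h6, ?_⟩
        rw [if_neg (by omega)]
      · rw [if_neg hak]
        have h5 : a = k + 2 ∧ b < d (k+2) := by
          split_ifs at h4 with h7
          · have : a = k + 2 := by omega
            subst this; exact ⟨rfl, h7⟩
          · omega
        obtain ⟨rfl, h5⟩ := h5
        have hk7 : d (k+2) ≤ d (k+1) := hk3
        have h6 : (k+1, b) ∈ skewCells lam mu := by
          rw [mem_skew, hmuS (k+1) (by omega)]
          omega
        refine ⟨h6, by omega, ?_⟩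
        rw [hnz]
        exact ⟨h6, by rw [if_pos (by omega)]⟩
    · rintro ⟨a, b⟩ h ⟨a', b'⟩ h' heq
      simp only [Finset.coe_filter, Set.mem_setOf_eq] at h h' heq
      have h3 := ((hnz a b (k+1)).1 h.2.2).2
      have h3' := ((hnz a' b' (k+1)).1 h'.2.2).2
      rw [Prod.mk.injEq]
      split_ifs at heq with e1 e2 e2 <;> rw [Prod.mk.injEq] at heq
      · omega
      · omega
      · omega
      · refine ⟨?_, heq.2⟩
        split_ifs at h3 h3' <;> omega
  · intro v
    have e : ((skewCells lam mu).filter fun p => fillT lam mu d p = v + 1) =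
        ({v} ×ˢ Finset.Ico (d v) (lam.rowLen v)) ∪ ({v+1} ×ˢ Finset.range (d (v+1))) := by
      ext ⟨a, b⟩
      rw [Finset.mem_filter, hnz, Finset.mem_union, Finset.mem_product, Finset.mem_product,
        Finset.mem_singleton, Finset.mem_singleton, Finset.mem_Ico, Finset.mem_range, mem_skew]
      simp only
      constructor
      · rintro ⟨h1, _, h3⟩
        split_ifs at h3 with h4
        · subst h3; right; exact ⟨rfl, h4⟩
        · have : a = v := by omega
          subst this; left; exact ⟨rfl, by omega, by omega⟩
      · rintro (⟨rfl, h1, h2⟩ | ⟨rfl, h1⟩)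
        · have : mu.rowLen a ≤ b := by
            rcases a with _ | a
            · omega
            · rw [hmuS (a+1) (by omega)]; omega
          exact ⟨⟨h2, this⟩, ⟨h2, this⟩, by rw [if_neg (by omega)]⟩
        · have := hdl (v+1)
          have := hmuS (v+1) (by omega)
          exact ⟨⟨by omega, by omega⟩, ⟨by omega, by omega⟩, by rw [if_pos h1]⟩
    unfold content
    rw [e, Finset.card_union_of_disjoint]
    · rw [Finset.card_product, Finset.card_product, Finset.card_singleton, Finset.card_singleton,
        Nat.card_Ico, Finset.card_range]
      have := hd v
      have := hdl v
      omega
    · rw [Finset.disjoint_left]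
      rintro ⟨a, b⟩ h1 h2
      rw [Finset.mem_product, Finset.mem_singleton] at h1 h2
      have := h1.1
      have := h2.1
      simp only at *
      omega

/-- The diagram with row lengths `x`. -/
def mkYD (n : ℕ) (x : ℕ → ℕ) (hx : Antitone x) : YoungDiagram :=
  ⟨(Finset.range n ×ˢ Finset.range (x 0)).filter fun p => p.2 < x p.1, by
    rintro ⟨a1, a2⟩ ⟨b1, b2⟩ hba ha
    simp only [Finset.coe_filter, Finset.mem_product, Finset.mem_range, Set.mem_setOf_eq] at ha ⊢
    have h1 : b1 ≤ a1 := hba.1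
    have h2 : b2 ≤ a2 := hba.2
    have := hx h1
    omega⟩

lemma mkYD_rowLen (n : ℕ) (x : ℕ → ℕ) (hx : Antitone x) (h0 : ∀ i, n ≤ i → x i = 0) (i : ℕ) :
    (mkYD n x hx).rowLen i = x i := by
  have key : ∀ j, j < (mkYD n x hx).rowLen i ↔ j < x i := by
    intro j
    rw [← mem_iff_lt_rowLen, ← mem_cells]
    unfold mkYD
    simp only [Finset.mem_filter, Finset.mem_product, Finset.mem_range]
    constructor
    · exact fun h => h.2
    · intro h
      refine ⟨⟨?_, ?_⟩, h⟩
      · by_contra hc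
        have := h0 i (by omega); omega
      · have := hx (Nat.zero_le i); omega
  have h1 := key (x i)
  have h2 := key ((mkYD n x hx).rowLen i)
  omega

lemma pieri (lam mu nu : YoungDiagram) (hmu : mu ≤ lam) (hm : mu.colLen 0 = 1) (n : ℕ)
    (hn : lam.colLen 0 ≤ n) (hn1 : 1 ≤ n) :
    lrCoeff lam mu nu ≠ 0 ↔ HS n lam.rowLen (mu.rowLen 0) nu.rowLen := by
  unfold lrCoeff
  rw [if_pos hmu]
  constructor
  · intro h
    obtain ⟨T, hT⟩ := Set.nonempty_of_ncard_ne_zero h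
    exact forward lam mu nu hmu hm n hn hn1 T hT
  · rintro ⟨h1, h2⟩
    have hzero : ∀ i, n ≤ i → lam.rowLen i = 0 := fun i hi => row_zero lam i (by omega)
    have hsum : ∀ k, ∑ j ∈ Finset.range k, nu.rowLen j ≤ ∑ j ∈ Finset.range k, lam.rowLen j :=
      fun k => Finset.sum_le_sum fun j _ => (h1 j).2
    have hmono : ∀ k, ∑ j ∈ Finset.range k, lam.rowLen j ≤
        ∑ j ∈ Finset.range k, nu.rowLen j + mu.rowLen 0 ∧
        (∑ j ∈ Finset.range k, nu.rowLen j + mu.rowLen 0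
          ≤ ∑ j ∈ Finset.range k, lam.rowLen j + lam.rowLen k) := by
      have hbig : ∀ t, ∑ j ∈ Finset.range (n + t), nu.rowLen j + mu.rowLen 0 =
          ∑ j ∈ Finset.range (n + t), lam.rowLen j := by
        intro t
        induction t with
        | zero => exact h2
        | succ t ih =>
          rw [← add_assoc, Finset.sum_range_succ, Finset.sum_range_succ]
          have := hzero (n + t) (by omega)
          have := h1 (n + t)
          omega
      have hstep : ∀ t k, k + t = n → ∑ j ∈ Finset.range k, lam.rowLen j ≤
          ∑ j ∈ Finset.range k, nu.rowLen j + mu.rowLen 0 ∧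
          (∑ j ∈ Finset.range k, nu.rowLen j + mu.rowLen 0
          ≤ ∑ j ∈ Finset.range k, lam.rowLen j + lam.rowLen k) := by
        intro t
        induction t with
        | zero => intro k hk; simp only [add_zero] at hk; subst hk; omega
        | succ t ih =>
          intro k hk
          have := ih (k+1) (by omega)
          rw [Finset.sum_range_succ, Finset.sum_range_succ] at this
          have := h1 k
          omega
      intro k
      by_cases hk : k ≤ n
      · exact hstep (n - k) k (by omega)
      · have := hbig (k - n)
        rw [show n + (k - n) = k by omega] at this
        omega
    have hmem : fillT lam mu (fun k => ∑ j ∈ Finset.range k, nu.rowLen j + mu.rowLen 0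
        - ∑ j ∈ Finset.range k, lam.rowLen j) ∈ {T : ℕ × ℕ → ℕ | IsLR lam mu nu T} := by
      refine backward lam mu nu hm _ (by simp) ?_ ?_ h1
      · intro i
        have t1 := hmono i
        have t2 := hmono (i+1)
        have t3 := h1 i
        simp only [Finset.sum_range_succ] at *
        omega
      · intro i
        have t1 := hmono i
        show _ - _ ≤ _
        omega
    exact ((Set.ncard_pos (lr_finite lam mu nu)).2 ⟨_, hmem⟩).ne'

lemma dp_corner (lam : YoungDiagram) (h : 4 ≤ dp lam) (i : ℕ) :
    ∃ k, k ≠ i ∧ k ≠ i + 1 ∧ lam.rowLen (k+1) < lam.rowLen k := by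
  by_contra hc
  push Not at hc
  have hsub : ((Finset.range (lam.colLen 0)).image fun i => lam.rowLen i) ⊆
      {lam.rowLen i, lam.rowLen (i+1)} := by
    intro v hv
    rw [Finset.mem_image] at hv
    obtain ⟨j, hj, rfl⟩ := hv
    rw [Finset.mem_range] at hj
    have hpos : 0 < lam.rowLen j := by
      rw [← mem_iff_lt_rowLen, mem_iff_lt_colLen]; exact hj
    rw [Finset.mem_insert, Finset.mem_singleton]
    by_contra hne
    push Not at hne
    have hconst : ∀ t, lam.rowLen (j + t) = lam.rowLen j := by
      intro t
      induction t with
      | zero => rfl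
      | succ t ih =>
        have h1 : j + t ≠ i := fun e => hne.1 (by rw [← e, ih])
        have h2 : j + t ≠ i + 1 := fun e => hne.2 (by rw [← e, ih])
        have h3 := hc (j + t) h1 h2
        have h4 := lam.rowLen_anti (j + t) (j + t + 1) (by omega)
        rw [← add_assoc]
        omega
    have := hconst (lam.colLen 0)
    rw [row_zero lam _ (by omega)] at this
    omega
  have h1 := Finset.card_le_card hsub
  have h2 : ({lam.rowLen i, lam.rowLen (i+1)} : Finset ℕ).card ≤ 2 := Finset.card_le_two
  unfold dp at h
  omega

lemma basic_bound (lam mu : YoungDiagram) (hmu : mu ≤ lam) (hm : mu.colLen 0 = 1)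
    (hb : IsBasic lam mu) : 1 ≤ mu.rowLen 0 ∧ mu.rowLen 0 ≤ lam.rowLen 1 := by
  have h1 : 1 ≤ mu.rowLen 0 := by
    have : (0, 0) ∈ mu := mem_iff_lt_colLen.2 (by omega)
    exact mem_iff_lt_rowLen.1 this
  refine ⟨h1, ?_⟩
  by_contra hc
  have hlast : (0, mu.rowLen 0 - 1) ∈ mu := mem_iff_lt_rowLen.2 (by omega)
  have h2 : mu.rowLen 0 - 1 < lam.rowLen 0 := mem_iff_lt_rowLen.1 (hmu hlast)
  have h3 := hb.2 _ h2
  have h4 := mem_iff_lt_colLen.1 hlast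
  have h5 : (1, mu.rowLen 0 - 1) ∈ lam := mem_iff_lt_colLen.2 (by omega)
  rw [mem_iff_lt_rowLen] at h5
  omega

lemma ext_row (a b : YoungDiagram) (h : ∀ i, a.rowLen i = b.rowLen i) : a = b := by
  ext ⟨i, j⟩
  rw [mem_cells, mem_cells, mem_iff_lt_rowLen, mem_iff_lt_rowLen, h]

/-- basic skew diagrams with single-row inner shapes (`m = b = 1`), outer
shapes with at least 4 distinct part sizes, and equal skew Schur functions are equal. -/
theorem single_row_inner_eq (lam mu alp bet : YoungDiagram)
    (hmu : mu ≤ lam) (hbet : bet ≤ alp)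
    (hm : mu.colLen 0 = 1) (hb : bet.colLen 0 = 1)
    (hdplam : 4 ≤ dp lam) (hdpalp : 4 ≤ dp alp)
    (hbasic1 : IsBasic lam mu) (hbasic2 : IsBasic alp bet)
    (h : SchurEq lam mu alp bet) :
    alp = lam ∧ bet = mu := by
  have b1 := basic_bound lam mu hmu hm hbasic1
  have b2 := basic_bound alp bet hbet hb hbasic2
  obtain ⟨n, hn, hn', hn1⟩ : ∃ n, lam.colLen 0 ≤ n ∧ alp.colLen 0 ≤ n ∧ 1 ≤ n :=
    ⟨lam.colLen 0 + alp.colLen 0 + 1, by omega, by omega, by omega⟩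
  have al : Antitone lam.rowLen := fun i j hij => lam.rowLen_anti i j hij
  have aa : Antitone alp.rowLen := fun i j hij => alp.rowLen_anti i j hij
  have zl : ∀ i, n ≤ i → lam.rowLen i = 0 := fun i hi => row_zero lam i (by omega)
  have za : ∀ i, n ≤ i → alp.rowLen i = 0 := fun i hi => row_zero alp i (by omega)
  have trans : ∀ nu : YoungDiagram, HS n lam.rowLen (mu.rowLen 0) nu.rowLen ↔
      HS n alp.rowLen (bet.rowLen 0) nu.rowLen := by
    intro nu
    rw [← pieri lam mu nu hmu hm n hn hn1, ← pieri alp bet nu hbet hb n hn' hn1, h nu]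
  have real : ∀ (a : ℕ → ℕ) (m : ℕ) (x : ℕ → ℕ), (∀ i, n ≤ i → a i = 0) → HS n a m x →
      ∃ nu : YoungDiagram, nu.rowLen = x := by
    intro a m x ha hx
    have hxa : Antitone x := antitone_nat_of_succ_le fun i => (hx.1 (i+1)).2.trans (hx.1 i).1
    refine ⟨mkYD n x hxa, funext fun i => mkYD_rowLen n x hxa (fun i hi => ?_) i⟩
    have := ha i hi
    have := hx.1 i
    omega
  have hS : ∀ x, HS n lam.rowLen (mu.rowLen 0) x ↔ HS n alp.rowLen (bet.rowLen 0) x := by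
    intro x
    constructor
    · intro hx
      obtain ⟨nu, rfl⟩ := real _ _ x zl hx
      exact (trans nu).1 hx
    · intro hx
      obtain ⟨nu, rfl⟩ := real _ _ x za hx
      exact (trans nu).2 hx
  have le1 := core n lam.rowLen alp.rowLen al aa zl za _ _ b1.1 b1.2 b2.2 hS (dp_corner lam hdplam)
  have le2 := core n alp.rowLen lam.rowLen aa al za zl _ _ b2.1 b2.2 b1.2 (fun x => (hS x).symm)
    (dp_corner alp hdpalp)
  have heq : alp = lam := ext_row _ _ fun i => le_antisymm (le1 i) (le2 i)
  refine ⟨heq, ext_row _ _ fun i => ?_⟩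
  rcases i with _ | i
  · subst heq
    obtain ⟨x, hx, _⟩ := ex_fix n alp.rowLen aa (za n le_rfl) (mu.rowLen 0) 0 (alp.rowLen 0)
      (by omega) (aa (by omega)) le_rfl (by simp only [zero_add]; omega) (by omega)
    have e1 := hx.2
    have e2 := ((hS x).1 hx).2
    omega
  · rw [mu_row mu hm _ (by omega), mu_row bet hb _ (by omega)]

end LRSkew
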